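/- Let m ≥ 3 and 1 ≤ i ≤ m−2, and work on F = ℂ(z_1,…,z_m). For u ∈ ℂ and 1 ≤ j ≤ m−1 define the ℂ-linear operator R_j(u) := id + (1 − exp(u))·𝒟_j on F. Then for all u, v ∈ ℂ one has the Yang–Baxter relation R_i(u) ∘ R_{i+1}(u+v) ∘ R_i(v) = R_{i+1}(v) ∘ R_i(u+v) ∘ R_{i+1}(u) as ℂ-linear operators on F. -/

import Mathlib

noncomputable section

abbrev FC (m : ℕ) := FractionRing (MvPolynomial (Fin m) ℂ)

noncomputable def z {m : ℕ} (a : Fin m) : FC m :=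
  algebraMap (MvPolynomial (Fin m) ℂ) (FC m) (MvPolynomial.X a)

/-- The image of a complex scalar in `ℂ(z_1,…,z_m)`. -/
noncomputable def cC {m : ℕ} (c : ℂ) : FC m :=
  algebraMap (MvPolynomial (Fin m) ℂ) (FC m) (MvPolynomial.C c)

/-- The ℂ-algebra automorphism of `ℂ(z_1,…,z_m)` exchanging `z_a` and `z_b`. -/
noncomputable def swapHom {m : ℕ} (a b : Fin m) : FC m →+* FC m :=
  IsFractionRing.lift (g := (algebraMap (MvPolynomial (Fin m) ℂ) (FC m)).comp
      (MvPolynomial.renameEquiv ℂ (Equiv.swap a b)).toRingEquiv.toRingHom)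
    ((IsFractionRing.injective (MvPolynomial (Fin m) ℂ) (FC m)).comp
      (MvPolynomial.renameEquiv ℂ (Equiv.swap a b)).injective)

/-- The modified divided difference operator `𝒟` associated with the pair `(z_a, z_b)`. -/
noncomputable def Dop {m : ℕ} (a b : Fin m) (f : FC m) : FC m :=
  z b / z a * ((z a * f - z b * swapHom a b f) / (z a - z b))

/-- The operator `R(u) = id + (1 − exp u)·𝒟` associated with the pair `(z_a, z_b)`. -/
noncomputable def Rop {m : ℕ} (a b : Fin m) (u : ℂ) (f : FC m) : FC m :=
  f + cC (1 - Complex.exp u) * Dop a b f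

@[simp]
theorem swapHom_algebraMap {m : ℕ} (a b : Fin m) (p : MvPolynomial (Fin m) ℂ) :
    swapHom a b (algebraMap _ (FC m) p) =
      algebraMap _ (FC m) (MvPolynomial.rename (Equiv.swap a b) p) := by
  simp [swapHom]

theorem swapHom_z {m : ℕ} (a b c : Fin m) : swapHom a b (z c) = z (Equiv.swap a b c) := by
  simp [z]

theorem swapHom_cC {m : ℕ} (a b : Fin m) (c : ℂ) : swapHom a b (cC c) = cC c := by
  simp [cC]

theorem swapHom_swapHom {m : ℕ} (a b : Fin m) (f : FC m) :
    swapHom a b (swapHom a b f) = f := by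
  have h : (swapHom a b).comp (swapHom a b) = RingHom.id (FC m) := by
    refine IsLocalization.ringHom_ext (nonZeroDivisors (MvPolynomial (Fin m) ℂ)) ?_
    refine RingHom.ext fun p => ?_
    simp [MvPolynomial.rename_rename, ← Equiv.Perm.coe_mul]
  exact congrArg (fun g : FC m →+* FC m => g f) h

theorem swapHom_braid {m : ℕ} {a b c : Fin m} (hab : a ≠ b) (hac : a ≠ c) (hbc : b ≠ c)
    (f : FC m) :
    swapHom a b (swapHom b c (swapHom a b f)) = swapHom b c (swapHom a b (swapHom b c f)) := by
  have hσ : Equiv.swap a b * Equiv.swap b c * Equiv.swap a b =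
      Equiv.swap b c * Equiv.swap a b * Equiv.swap b c := by
    rw [Equiv.swap_mul_swap_mul_swap hab hac, Equiv.swap_comm a b, Equiv.swap_comm b c,
      Equiv.swap_mul_swap_mul_swap hbc.symm hac.symm, Equiv.swap_comm]
  have h : (swapHom a b).comp ((swapHom b c).comp (swapHom a b)) =
      (swapHom b c).comp ((swapHom a b).comp (swapHom b c)) := by
    refine IsLocalization.ringHom_ext (nonZeroDivisors (MvPolynomial (Fin m) ℂ)) ?_
    refine RingHom.ext fun p => ?_
    simp only [RingHom.comp_apply, swapHom_algebraMap, MvPolynomial.rename_rename,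
      ← Equiv.Perm.coe_mul, ← mul_assoc, hσ]
  exact congrArg (fun g : FC m →+* FC m => g f) h

theorem z_injective {m : ℕ} : Function.Injective (z : Fin m → FC m) :=
  (IsFractionRing.injective (MvPolynomial (Fin m) ℂ) (FC m)).comp MvPolynomial.X_injective

theorem z_ne_zero {m : ℕ} (a : Fin m) : (z a : FC m) ≠ 0 := by
  simp [z]

theorem Dop_add {m : ℕ} (a b : Fin m) (f g : FC m) : Dop a b (f + g) = Dop a b f + Dop a b g := by
  simp only [Dop, map_add]
  ring

theorem Dop_cC_mul {m : ℕ} (a b : Fin m) (c : ℂ) (f : FC m) :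
    Dop a b (cC c * f) = cC c * Dop a b f := by
  simp only [Dop, map_mul, swapHom_cC]
  ring

theorem Dop_Dop {m : ℕ} {a b : Fin m} (hab : a ≠ b) (f : FC m) :
    Dop a b (Dop a b f) = -Dop a b f := by
  have ha := z_ne_zero a
  have hb := z_ne_zero b
  have h : (z a : FC m) - z b ≠ 0 := sub_ne_zero.mpr (z_injective.ne hab)
  have h' : (z b : FC m) - z a ≠ 0 := sub_ne_zero.mpr (z_injective.ne hab.symm)
  simp only [Dop, map_mul, map_sub, map_div₀, swapHom_z, swapHom_swapHom,
    Equiv.swap_apply_left, Equiv.swap_apply_right]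
  rw [← neg_sub (z a) (z b)]
  field_simp
  ring

theorem Dop_braid {m : ℕ} {a b c : Fin m} (hab : a ≠ b) (hac : a ≠ c) (hbc : b ≠ c) (f : FC m) :
    Dop a b (Dop b c (Dop a b f)) = Dop b c (Dop a b (Dop b c f)) := by
  have ha := z_ne_zero a
  have hb := z_ne_zero b
  have hc := z_ne_zero c
  have h₁ : (z a : FC m) - z b ≠ 0 := sub_ne_zero.mpr (z_injective.ne hab)
  have h₂ : (z b : FC m) - z c ≠ 0 := sub_ne_zero.mpr (z_injective.ne hbc)
  have h₃ : (z a : FC m) - z c ≠ 0 := sub_ne_zero.mpr (z_injective.ne hac)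
  simp only [Dop, map_mul, map_sub, map_div₀, swapHom_z, swapHom_swapHom,
    Equiv.swap_apply_left, Equiv.swap_apply_right, Equiv.swap_apply_of_ne_of_ne hac.symm hbc.symm,
    Equiv.swap_apply_of_ne_of_ne hab hac, swapHom_braid hab hac hbc]
  rw [← neg_sub (z a) (z b), ← neg_sub (z b) (z c)]
  generalize swapHom b c (swapHom a b (swapHom b c f)) = f₅
  generalize swapHom b c (swapHom a b f) = f₄
  generalize swapHom a b (swapHom b c f) = f₃
  generalize swapHom b c f = f₂
  generalize swapHom a b f = f₁
  generalize (z a : FC m) = x at *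
  generalize (z b : FC m) = y at *
  generalize (z c : FC m) = w at *
  field_simp
  ring

theorem cC_one_sub_exp_add {m : ℕ} (u v : ℂ) :
    (cC (1 - Complex.exp (u + v)) : FC m) = cC (1 - Complex.exp u) + cC (1 - Complex.exp v) -
      cC (1 - Complex.exp u) * cC (1 - Complex.exp v) := by
  simp only [cC, Complex.exp_add, ← map_mul, ← map_add, ← map_sub]
  congr 2
  ring

theorem Rop_yang_baxter {m : ℕ} {a b c : Fin m} (hab : a ≠ b) (hac : a ≠ c) (hbc : b ≠ c)
    (u v : ℂ) (f : FC m) :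
    Rop a b u (Rop b c (u + v) (Rop a b v f)) = Rop b c v (Rop a b (u + v) (Rop b c u f)) := by
  simp only [Rop, Dop_add, Dop_cC_mul, Dop_Dop hab, Dop_Dop hbc, Dop_braid hab hac hbc]
  rw [cC_one_sub_exp_add]
  ring

/-- the Yang–Baxter relation
`R_i(u) R_{i+1}(u+v) R_i(v) = R_{i+1}(v) R_i(u+v) R_{i+1}(u)`
(0-based index `i`, corresponding to the 1-based index `i' = i + 1` with
`1 ≤ i' ≤ m − 2`). -/
theorem statement15 (m : ℕ) (hm : 3 ≤ m) (i : ℕ) (hi : i + 2 < m) (u v : ℂ)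
    (f : FC m) :
    Rop ⟨i, by omega⟩ ⟨i + 1, by omega⟩ u
        (Rop ⟨i + 1, by omega⟩ ⟨i + 2, hi⟩ (u + v)
          (Rop ⟨i, by omega⟩ ⟨i + 1, by omega⟩ v f))
      = Rop ⟨i + 1, by omega⟩ ⟨i + 2, hi⟩ v
          (Rop ⟨i, by omega⟩ ⟨i + 1, by omega⟩ (u + v)
            (Rop ⟨i + 1, by omega⟩ ⟨i + 2, hi⟩ u f)) := by
  apply Rop_yang_baxter <;> simp

end
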